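/- arXiv:2406.19909 — 3 statements merged into one kernel-verified Lean document; each statement's English description precedes it below -/
import Mathlib

section
/- Let f : G → H be a function between groups. Then its left defect set D(f) := {f(y)⁻¹f(x)⁻¹f(xy) | x, y ∈ G} is finite if and only if its right defect set D*(f) := {f(x)f(y)f(xy)⁻¹ | x, y ∈ G} is finite. -/
open Set Filter Pointwise

section Defs

variable {X Y G H : Type*}

/-- `d` is a metric on `X`. -/
def IsMetric (d : X → X → ℝ) : Prop :=
  (∀ x y, 0 ≤ d x y) ∧ (∀ x y, d x y = 0 ↔ x = y) ∧ (∀ x y, d x y = d y x) ∧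
    (∀ x y z, d x z ≤ d x y + d y z)

/-- `d` is a left-invariant metric on the group `G`. -/
def IsLeftInvariant [Group G] (d : G → G → ℝ) : Prop :=
  ∀ g x y : G, d (g * x) (g * y) = d x y

/-- `d` is proper: closed balls are compact, where a countable group is regarded as a
discrete topological space. -/
def IsProperMetric (d : G → G → ℝ) : Prop :=
  ∀ (x : G) (r : ℝ), @IsCompact G ⊥ {y | d x y ≤ r}

/-- The (left) defect set `D(f) = {f(y)⁻¹ f(x)⁻¹ f(xy) | x y ∈ G}` of a map between groups. -/
def defectSet [Group G] [Group H] (f : G → H) : Set H :=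
  {h | ∃ x y : G, h = (f y)⁻¹ * (f x)⁻¹ * f (x * y)}

/-- `f` is a quasimorphism if its defect set is finite. -/
def IsQuasimorphism [Group G] [Group H] (f : G → H) : Prop :=
  (defectSet f).Finite

/-- `f` is symmetric: `f(a⁻¹) = f(a)⁻¹`. -/
def IsSymmetricMap [Group G] [Group H] (f : G → H) : Prop :=
  ∀ a : G, f a⁻¹ = (f a)⁻¹

/-- `f` is unital: `f(e) = e`. -/
def IsUnitalMap [Group G] [Group H] (f : G → H) : Prop :=
  f 1 = 1

/-- `Λ` is an approximate subgroup of `G`: symmetric, unital and `Λ² ⊆ ΛF` for a finite `F`. -/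
def IsApproxSubgroup [Group G] (Λ : Set G) : Prop :=
  Λ⁻¹ = Λ ∧ (1 : G) ∈ Λ ∧ ∃ F : Set G, F.Finite ∧ Λ * Λ ⊆ Λ * F

/-- The subset `s` of `X` has asymptotic dimension at most `n`, with respect to the
(restriction of the) metric `d`: for every `R > 0` there is a cover of `s` by subsets of `s`,
uniformly bounded by some `D > 0`, splitting into `n + 1` `R`-disjoint families. -/
def ASDimLE (d : X → X → ℝ) (s : Set X) (n : ℕ) : Prop :=
  ∀ R : ℝ, 0 < R → ∃ D : ℝ, 0 < D ∧ ∃ 𝒰 : Fin (n + 1) → Set (Set X),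
    (∀ i, ∀ u ∈ 𝒰 i, u ⊆ s) ∧
    (s ⊆ ⋃ i, ⋃₀ 𝒰 i) ∧
    (∀ i, ∀ u ∈ 𝒰 i, ∀ x ∈ u, ∀ y ∈ u, d x y ≤ D) ∧
    (∀ i, ∀ u ∈ 𝒰 i, ∀ v ∈ 𝒰 i, u ≠ v → ∀ x ∈ u, ∀ y ∈ v, R ≤ d x y)

/-- The asymptotic dimension of the subset `s` of `X` with respect to the metric `d`,
as an element of `ℕ∞` (`⊤` means infinite asymptotic dimension). -/
noncomputable def asdim (d : X → X → ℝ) (s : Set X) : ℕ∞ :=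
  sInf ((fun n : ℕ => (n : ℕ∞)) '' {n | ASDimLE d s n})

/-- A family `𝒴` of subsets of `X` has asymptotic dimension uniformly bounded by `n`: for
every `R > 0` there is a common `D > 0` such that every member admits a `D`-bounded cover
splitting into `n + 1` `R`-disjoint families. -/
def ASDimUnifLE {ι : Type*} (d : X → X → ℝ) (𝒴 : ι → Set X) (n : ℕ) : Prop :=
  ∀ R : ℝ, 0 < R → ∃ D : ℝ, 0 < D ∧ ∀ α : ι, ∃ 𝒰 : Fin (n + 1) → Set (Set X),
    (∀ i, ∀ u ∈ 𝒰 i, u ⊆ 𝒴 α) ∧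
    (𝒴 α ⊆ ⋃ i, ⋃₀ 𝒰 i) ∧
    (∀ i, ∀ u ∈ 𝒰 i, ∀ x ∈ u, ∀ y ∈ u, d x y ≤ D) ∧
    (∀ i, ∀ u ∈ 𝒰 i, ∀ v ∈ 𝒰 i, u ≠ v → ∀ x ∈ u, ∀ y ∈ v, R ≤ d x y)

/-- `f` is coarsely Lipschitz on the subset `s`. -/
def IsCoarselyLipschitzOn (dX : X → X → ℝ) (dY : Y → Y → ℝ) (s : Set X) (f : X → Y) : Prop :=
  ∃ Φ : ℝ → ℝ, (∀ t, 0 ≤ t → 0 ≤ Φ t) ∧ MonotoneOn Φ (Ici (0 : ℝ)) ∧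
    Tendsto Φ atTop atTop ∧ ∀ x ∈ s, ∀ x' ∈ s, dY (f x) (f x') ≤ Φ (dX x x')

/-- `f` is coarsely Lipschitz: `d_Y(f x, f x') ≤ Φ₊(d_X(x, x'))` for a non-decreasing
`Φ₊ : [0,∞) → [0,∞)` tending to `∞`. -/
def IsCoarselyLipschitz (dX : X → X → ℝ) (dY : Y → Y → ℝ) (f : X → Y) : Prop :=
  ∃ Φ : ℝ → ℝ, (∀ t, 0 ≤ t → 0 ≤ Φ t) ∧ MonotoneOn Φ (Ici (0 : ℝ)) ∧
    Tendsto Φ atTop atTop ∧ ∀ x x' : X, dY (f x) (f x') ≤ Φ (dX x x')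

/-- `f` is a coarse equivalence from `(s, dX)` to `(t, dY)`: a coarse embedding whose image
is coarsely dense in `t`. -/
def IsCoarseEquivOn (dX : X → X → ℝ) (dY : Y → Y → ℝ) (s : Set X) (t : Set Y) (f : X → Y) :
    Prop :=
  MapsTo f s t ∧
  (∃ Φm Φp : ℝ → ℝ, (∀ u, 0 ≤ u → 0 ≤ Φm u) ∧ (∀ u, 0 ≤ u → 0 ≤ Φp u) ∧
    MonotoneOn Φm (Ici (0 : ℝ)) ∧ MonotoneOn Φp (Ici (0 : ℝ)) ∧
    Tendsto Φm atTop atTop ∧ Tendsto Φp atTop atTop ∧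
    ∀ x ∈ s, ∀ x' ∈ s,
      Φm (dX x x') ≤ dY (f x) (f x') ∧ dY (f x) (f x') ≤ Φp (dX x x')) ∧
  ∃ L : ℝ, 0 < L ∧ ∀ y ∈ t, ∃ x ∈ s, dY y (f x) < L

/-- `f : (X, dX) → (Y, dY)` is a coarse equivalence. -/
def IsCoarseEquiv (dX : X → X → ℝ) (dY : Y → Y → ℝ) (f : X → Y) : Prop :=
  IsCoarseEquivOn dX dY univ univ f

end Defs
/-- the left defect set of `f : G → H` is finite iff the right defect set
`D*(f) = {f(x)f(y)f(xy)⁻¹ | x, y ∈ G}` is finite. -/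
theorem defectSet_finite_iff_right_defectSet_finite
    {G H : Type*} [Group G] [Group H] (f : G → H) :
    (defectSet f).Finite ↔ {h : H | ∃ x y : G, h = f x * f y * (f (x * y))⁻¹}.Finite := by
  constructor
  · intro h
    set D := defectSet f with hD
    have hd : ∀ x y, (f y)⁻¹ * (f x)⁻¹ * f (x * y) ∈ D := fun x y => ⟨x, y, rfl⟩
    have hfin : ({f 1} * D⁻¹ * (D * D * D⁻¹)⁻¹ * D * {(f 1)⁻¹} : Set H).Finite :=
      ((((Set.finite_singleton _).mul h.inv).mul ((h.mul h).mul h.inv).inv).mul h).mul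
        (Set.finite_singleton _)
    refine hfin.subset ?_
    rintro _ ⟨x, y, rfl⟩
    have h1 := hd (x * y) (x * y)⁻¹
    have h2 := hd y (x * y)⁻¹
    have h3 := hd x (y * (x * y)⁻¹)
    have key := Set.mul_mem_mul (Set.mul_mem_mul (Set.mul_mem_mul (Set.mul_mem_mul
      (Set.mem_singleton (f 1)) (Set.inv_mem_inv.2 h1))
      (Set.inv_mem_inv.2 (Set.mul_mem_mul (Set.mul_mem_mul h2 h3) (Set.inv_mem_inv.2 h1)))) h1)
      (Set.mem_singleton ((f 1)⁻¹))
    convert key using 1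
    rw [← mul_assoc x y, mul_inv_cancel]
    group
  · intro h
    set E := {h : H | ∃ x y : G, h = f x * f y * (f (x * y))⁻¹} with hE
    have he : ∀ x y, f x * f y * (f (x * y))⁻¹ ∈ E := fun x y => ⟨x, y, rfl⟩
    have hfin : ({(f 1)⁻¹} * E⁻¹ * (E * E * E⁻¹)⁻¹ * E * {f 1} : Set H).Finite :=
      ((((Set.finite_singleton _).mul h.inv).mul ((h.mul h).mul h.inv).inv).mul h).mul
        (Set.finite_singleton _)
    refine hfin.subset ?_
    rintro _ ⟨x, y, rfl⟩
    have h1 := he (x * y)⁻¹ (x * y)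
    have h2 := he (x * y)⁻¹ x
    have h3 := he ((x * y)⁻¹ * x) y
    have key := Set.mul_mem_mul (Set.mul_mem_mul (Set.mul_mem_mul (Set.mul_mem_mul
      (Set.mem_singleton ((f 1)⁻¹)) (Set.inv_mem_inv.2 h1))
      (Set.inv_mem_inv.2 (Set.mul_mem_mul (Set.mul_mem_mul h2 h3) (Set.inv_mem_inv.2 h1)))) h1)
      (Set.mem_singleton (f 1))
    convert key using 1
    rw [mul_assoc _ x y, inv_mul_cancel]
    group
end

section
/- Let (Ξ, Ξ^∞) and (Λ, Λ^∞) be countable approximate groups, let f : (Ξ, Ξ^∞) → (Λ, Λ^∞) be a symmetric unital quasimorphism with f(Ξ) = Λ, let d' be a left-invariant proper metric on Λ^∞, let r > 0, let λ ∈ Λ, and let ξ_λ ∈ Ξ with f(ξ_λ) = λ. Then (f|_Ξ)⁻¹(B'(λ, r) ∩ Λ) ⊆ ξ_λ · f⁻¹((B'(e_Λ, r) ∩ Λ²) · D(f)), where B'(x, r) denotes the open r-ball in (Λ^∞, d') and D(f) is the defect set of f. -/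
open Set Filter Pointwise

/-- for a symmetric unital quasimorphism `f` of countable approximate groups
with `f(Ξ) = Λ`, `λ ∈ Λ`, `ξ_λ ∈ Ξ` with `f(ξ_λ) = λ` and `r > 0`, we have
`(f|_Ξ)⁻¹(B'(λ, r) ∩ Λ) ⊆ ξ_λ · f⁻¹((B'(e, r) ∩ Λ²) · D(f))`. -/
theorem preimage_ball_subset_translate
    {G H : Type*} [Group G] [Group H] [Countable G] [Countable H]
    (Ξ : Set G) (Λ : Set H)
    (hΞ : IsApproxSubgroup Ξ) (hΛ : IsApproxSubgroup Λ)
    (hΞgen : Subgroup.closure Ξ = ⊤) (hΛgen : Subgroup.closure Λ = ⊤)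
    (f : G → H) (hqm : IsQuasimorphism f) (hsym : IsSymmetricMap f) (hun : IsUnitalMap f)
    (hsurj : f '' Ξ = Λ)
    (d' : H → H → ℝ) (hd' : IsMetric d') (hd'li : IsLeftInvariant d')
    (hd'p : IsProperMetric d')
    (r : ℝ) (hr : 0 < r) (lam : H) (hlam : lam ∈ Λ)
    (ξ : G) (hξ : ξ ∈ Ξ) (hfξ : f ξ = lam) :
    {x ∈ Ξ | f x ∈ {z : H | d' lam z < r} ∩ Λ} ⊆
      (fun g => ξ * g) '' (f ⁻¹' (({z : H | d' 1 z < r} ∩ (Λ * Λ)) * defectSet f)) := by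
  rintro x ⟨hx, hball, hxΛ⟩
  refine ⟨ξ⁻¹ * x, ?_, by simp⟩
  refine Set.mem_mul.2 ⟨lam⁻¹ * f x, ⟨?_, ?_⟩, (f x)⁻¹ * (f ξ⁻¹)⁻¹ * f (ξ⁻¹ * x), ⟨ξ⁻¹, x, rfl⟩, ?_⟩
  · have h := hd'li lam⁻¹ lam (f x)
    rw [inv_mul_cancel] at h
    show d' 1 (lam⁻¹ * f x) < r
    rw [h]
    exact hball
  · refine Set.mul_mem_mul ?_ hxΛ
    rw [← hΛ.1]
    exact Set.inv_mem_inv.2 hlam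
  · rw [hsym ξ, hfξ]
    group
end

section
/- Let (Ξ, Ξ^∞) and (Λ, Λ^∞) be countable approximate groups, let f : (Ξ, Ξ^∞) → (Λ, Λ^∞) be a symmetric unital quasimorphism, let d be a left-invariant proper metric on Ξ^∞ and d' a left-invariant proper metric on Λ^∞, and let r > 0. Then there exists R > 0 such that f⁻¹((B'(e_Λ, r) ∩ Λ²) · D(f)) is contained in the open R-neighborhood of f⁻¹(D(f)) in (Ξ^∞, d), where B'(e_Λ, r) is the open r-ball in (Λ^∞, d') and D(f) is the defect set of f. Consequently asdim f⁻¹((B'(e_Λ, r) ∩ Λ²) · D(f)) ≤ asdim f⁻¹(D(f)). -/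
open Set Filter Pointwise

theorem ASDimLE.of_nbhd {X : Type*} {d : X → X → ℝ} (hd : IsMetric d) {A B : Set X} {R₀ : ℝ}
    (hR₀ : 0 < R₀) (h : A ⊆ {x | ∃ a ∈ B, d x a < R₀}) {n : ℕ} (hB : ASDimLE d B n) :
    ASDimLE d A n := by
  obtain ⟨-, -, hs, ht⟩ := hd
  intro R hR
  obtain ⟨D, hD, U, -, h2, h3, h4⟩ := hB (R + 2 * R₀) (by linarith)
  refine ⟨D + 2 * R₀, by linarith,
    fun i => (fun u => {x | x ∈ A ∧ ∃ a ∈ u, d x a < R₀}) '' U i, ?_, ?_, ?_, ?_⟩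
  · rintro i _ ⟨u, hu, rfl⟩ x hx
    exact hx.1
  · intro x hx
    obtain ⟨a, ha, hxa⟩ := h hx
    obtain ⟨i, hi⟩ := mem_iUnion.1 (h2 ha)
    obtain ⟨u, hu, hau⟩ := hi
    exact mem_iUnion.2 ⟨i, _, ⟨u, hu, rfl⟩, hx, a, hau, hxa⟩
  · rintro i _ ⟨u, hu, rfl⟩ x ⟨-, a, ha, hxa⟩ y ⟨-, b, hb, hyb⟩
    have := h3 i u hu a ha b hb
    have := ht x a y
    have := ht a b y
    have := hs b y
    linarith
  · rintro i _ ⟨u, hu, rfl⟩ _ ⟨v, hv, rfl⟩ hne x ⟨-, a, ha, hxa⟩ y ⟨-, b, hb, hyb⟩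
    have huv : u ≠ v := fun e => hne (by rw [e])
    have := h4 i u hu v hv huv a ha b hb
    have := ht a x b
    have := ht x y b
    have := hs a x
    linarith

/-- for a symmetric unital quasimorphism `f` of countable approximate groups
and `r > 0`, the set `f⁻¹((B'(e, r) ∩ Λ²) · D(f))` is contained in an `R`-neighborhood of
`f⁻¹(D(f))` for some `R > 0`; consequently its asymptotic dimension is at most
`asdim f⁻¹(D(f))`. -/
theorem preimage_subset_nbhd_preimage_defect
    {G H : Type*} [Group G] [Group H] [Countable G] [Countable H]
    (Ξ : Set G) (Λ : Set H)
    (hΞ : IsApproxSubgroup Ξ) (hΛ : IsApproxSubgroup Λ)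
    (hΞgen : Subgroup.closure Ξ = ⊤) (hΛgen : Subgroup.closure Λ = ⊤)
    (f : G → H) (hqm : IsQuasimorphism f) (hsym : IsSymmetricMap f) (hun : IsUnitalMap f)
    (hmaps : f '' Ξ ⊆ Λ)
    (d : G → G → ℝ) (hd : IsMetric d) (hdli : IsLeftInvariant d) (hdp : IsProperMetric d)
    (d' : H → H → ℝ) (hd' : IsMetric d') (hd'li : IsLeftInvariant d')
    (hd'p : IsProperMetric d')
    (r : ℝ) (hr : 0 < r) :
    (∃ R : ℝ, 0 < R ∧
      f ⁻¹' (({z : H | d' 1 z < r} ∩ (Λ * Λ)) * defectSet f) ⊆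
        {x : G | ∃ a ∈ f ⁻¹' defectSet f, d x a < R}) ∧
    asdim d (f ⁻¹' (({z : H | d' 1 z < r} ∩ (Λ * Λ)) * defectSet f)) ≤
      asdim d (f ⁻¹' defectSet f) := by
  have key : ∃ R : ℝ, 0 < R ∧
      f ⁻¹' (({z : H | d' 1 z < r} ∩ (Λ * Λ)) * defectSet f) ⊆
        {x : G | ∃ a ∈ f ⁻¹' defectSet f, d x a < R} := by
    have hball : {z : H | d' 1 z < r}.Finite := by
      let _ : TopologicalSpace H := ⊥
      have : DiscreteTopology H := ⟨rfl⟩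
      have hc : IsCompact {y : H | d' 1 y ≤ r} := hd'p 1 r
      exact hc.finite_of_discrete.subset (fun z (hz : d' 1 z < r) => show d' 1 z ≤ r from hz.le)
    have hK : (({z : H | d' 1 z < r} ∩ (Λ * Λ)) * defectSet f).Finite :=
      (hball.subset inter_subset_left).mul hqm
    obtain ⟨M, hM⟩ := (hK.image (fun k => d 1 (Function.invFun f k)⁻¹)).bddAbove
    refine ⟨max M 0 + 1, by positivity, fun x hx => ?_⟩
    have hf : f (Function.invFun f (f x)) = f x := Function.invFun_eq ⟨x, rfl⟩
    refine ⟨x * (Function.invFun f (f x))⁻¹, ?_, ?_⟩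
    · refine ⟨x, (Function.invFun f (f x))⁻¹, ?_⟩
      rw [hsym, hf]
      simp
    · have h1 := hM (mem_image_of_mem _ hx)
      have h2 := hdli x 1 (Function.invFun f (f x))⁻¹
      rw [mul_one] at h2
      rw [h2]
      have := le_max_left M 0
      linarith
  refine ⟨key, ?_⟩
  obtain ⟨R, hR, hsub⟩ := key
  exact sInf_le_sInf (image_mono fun n hn => ASDimLE.of_nbhd hd hR hsub hn)
end
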